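/- Let G be a finite connected simple graph with vertex set V, |V| = k ≥ 2. Then the meteor kernel of G admits a unique invariant probability measure Q on the state space S_G = {f : V → ℝ : f ≥ 0, ∑_{v∈V} f(v) = k}, and for every probability measure μ on S_G, the distribution of the chain after n steps started from μ converges weakly to Q as n → ∞. In particular, Q does not depend on the initial distribution. -/

import Mathlib

open scoped Classical ENNReal
open MeasureTheory Filter Topology

/-- The meteor redistribution map `A_x` of a simple graph `G`: the mass at `x` is set to `0`
and distributed equally among the neighbors of `x`. -/
noncomputable def meteorMap {V : Type*} (G : SimpleGraph V) (x : V) (f : V → ℝ) : V → ℝ :=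
  fun y =>
    if y = x then 0
    else if G.Adj x y then f y + f x / ((G.neighborSet x).ncard : ℝ)
    else f y

/-- The state space of the meteor process: nonnegative mass configurations of total mass `|V|`. -/
def massStates (V : Type*) : Set (V → ℝ) :=
  {f | (∀ v, 0 ≤ f v) ∧ ∑ᶠ v, f v = (Nat.card V : ℝ)}

/-- One step of the (discrete-time) meteor kernel applied to a measure: a uniformly random
vertex `x` is chosen and the meteor map `A_x` is applied, i.e. the new distribution is
`(1/|V|) ∑_x μ ∘ A_x⁻¹`. -/
noncomputable def meteorStep {V : Type*} (G : SimpleGraph V) (μ : Measure (V → ℝ)) :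
    Measure (V → ℝ) :=
  (Nat.card V : ℝ≥0∞)⁻¹ • ∑ᶠ x : V, μ.map (meteorMap G x)

section MeteorMap

variable {V : Type*} {G : SimpleGraph V}

theorem meteorMap_eq (x : V) (f : V → ℝ) (y : V) :
    meteorMap G x f y = f y - (if y = x then f x else 0) +
      (if G.Adj x y then f x / ((G.neighborSet x).ncard : ℝ) else 0) := by
  unfold meteorMap
  split_ifs with h1 h2 h2
  · exact absurd (h1 ▸ h2) (G.irrefl)
  · simp [h1]
  · ring
  · ring

/-- The meteor map as a linear map. -/
noncomputable def meteorLin (G : SimpleGraph V) (x : V) : (V → ℝ) →ₗ[ℝ] (V → ℝ) where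
  toFun := meteorMap G x
  map_add' f g := by
    ext y
    simp only [meteorMap, Pi.add_apply]
    split_ifs <;> ring
  map_smul' c f := by
    ext y
    simp only [meteorMap, Pi.smul_apply, smul_eq_mul, RingHom.id_apply]
    split_ifs <;> ring

@[simp] theorem meteorLin_apply (x : V) (f : V → ℝ) : meteorLin G x f = meteorMap G x f := rfl

theorem meteorMap_sub (x : V) (f g : V → ℝ) :
    meteorMap G x (f - g) = meteorMap G x f - meteorMap G x g :=
  (meteorLin G x).map_sub f g

theorem meteorMap_nonneg {f : V → ℝ} (hf : ∀ v, 0 ≤ f v) (x y : V) : 0 ≤ meteorMap G x f y := by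
  unfold meteorMap
  have := hf x
  have := hf y
  split_ifs <;> positivity

/-- Apply the meteor maps at the vertices of a list, from left to right. -/
noncomputable def meteorComp (G : SimpleGraph V) : List V → (V → ℝ) →ₗ[ℝ] (V → ℝ)
  | [] => LinearMap.id
  | x :: L => meteorComp G L ∘ₗ meteorLin G x

@[simp] theorem meteorComp_nil (f : V → ℝ) : meteorComp G [] f = f := rfl

@[simp] theorem meteorComp_cons (x : V) (L : List V) (f : V → ℝ) :
    meteorComp G (x :: L) f = meteorComp G L (meteorMap G x f) := rfl

theorem meteorComp_append (L L' : List V) (f : V → ℝ) :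
    meteorComp G (L ++ L') f = meteorComp G L' (meteorComp G L f) := by
  induction L generalizing f with
  | nil => rfl
  | cons x L ih => simp [ih]

theorem meteorComp_nonneg (L : List V) {f : V → ℝ} (hf : ∀ v, 0 ≤ f v) (y : V) :
    0 ≤ meteorComp G L f y := by
  induction L generalizing f with
  | nil => exact hf y
  | cons x L ih => exact ih (meteorMap_nonneg hf x)

/-- Mass at a vertex that is not hit can only grow. -/
theorem le_meteorComp_of_notMem {r : V} {L : List V} (hr : r ∉ L) {f : V → ℝ}
    (hf : ∀ v, 0 ≤ f v) : f r ≤ meteorComp G L f r := by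
  induction L generalizing f with
  | nil => exact le_rfl
  | cons x L ih =>
    rw [List.mem_cons, not_or] at hr
    refine le_trans ?_ (ih hr.2 (meteorMap_nonneg hf x))
    have := hf x
    rw [meteorLin_apply, meteorMap, if_neg hr.1]
    split_ifs
    · exact le_add_of_nonneg_right (by positivity)
    · exact le_rfl

/-- Hitting the vertices of a walk in order carries some mass from its start to its end. -/
theorem exists_meteorComp_pos_of_walk (hG : ∀ x, 0 < (G.neighborSet x).ncard) {v r : V}
    (p : G.Walk v r) {f : V → ℝ} (hf : ∀ w, 0 ≤ f w) (hv : 0 < f v) :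
    ∃ L : List V, r ∉ L ∧ 0 < meteorComp G L f r := by
  induction p generalizing f with
  | nil => exact ⟨[], by simp, hv⟩
  | @cons v w r hadj p ih =>
    by_cases hvr : v = r
    · exact ⟨[], by simp, hvr ▸ hv⟩
    · have hw : 0 < meteorMap G v f w := by
        have hd : (0 : ℝ) < (G.neighborSet v).ncard := by exact_mod_cast hG v
        have := hf w
        rw [meteorMap, if_neg hadj.ne', if_pos hadj]
        positivity
      obtain ⟨L, hL, hpos⟩ := ih (meteorMap_nonneg hf v) hw
      exact ⟨v :: L, by simp [hL, Ne.symm hvr], hpos⟩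

variable [Fintype V]

theorem mem_massStates {f : V → ℝ} :
    f ∈ massStates V ↔ (∀ v, 0 ≤ f v) ∧ ∑ v, f v = (Fintype.card V : ℝ) := by
  simp [massStates, finsum_eq_sum_of_fintype]

theorem isCompact_massStates : IsCompact (massStates V) := by
  have hclosed : IsClosed (massStates V) := by
    have : massStates V =
        (⋂ v, {f : V → ℝ | 0 ≤ f v}) ∩ {f : V → ℝ | ∑ v, f v = (Fintype.card V : ℝ)} := by
      ext f
      simp [mem_massStates]
    rw [this]
    exact (isClosed_iInter fun v => isClosed_le continuous_const (continuous_apply v)).inter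
      (isClosed_eq (by fun_prop) continuous_const)
  refine (isCompact_univ_pi fun _ : V => isCompact_Icc (a := (0 : ℝ))
    (b := (Fintype.card V : ℝ))).of_isClosed_subset hclosed fun f hf v _ => ?_
  obtain ⟨h0, h1⟩ := mem_massStates.1 hf
  exact ⟨h0 v, h1 ▸ Finset.single_le_sum (fun w _ => h0 w) (Finset.mem_univ v)⟩

theorem continuous_meteorMap (x : V) : Continuous (meteorMap G x) :=
  (meteorLin G x).continuous_of_finiteDimensional

theorem sum_meteorMap (hG : ∀ x, 0 < (G.neighborSet x).ncard) (x : V) (f : V → ℝ) :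
    ∑ y, meteorMap G x f y = ∑ y, f y := by
  have hc : ((Finset.univ.filter fun y => G.Adj x y).card : ℝ) = (G.neighborSet x).ncard := by
    rw [← Set.ncard_coe_finset]
    congr 2
    ext y
    simp
  have h0 : ((G.neighborSet x).ncard : ℝ) ≠ 0 := by exact_mod_cast (hG x).ne'
  simp only [meteorMap_eq, Finset.sum_add_distrib, Finset.sum_sub_distrib,
    Finset.sum_ite_eq', Finset.mem_univ, if_true]
  rw [← Finset.sum_filter, Finset.sum_const, nsmul_eq_mul, hc, mul_div_cancel₀ _ h0]
  ring

theorem meteorMap_mem_massStates (hG : ∀ x, 0 < (G.neighborSet x).ncard) (x : V) {f : V → ℝ}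
    (hf : f ∈ massStates V) : meteorMap G x f ∈ massStates V := by
  rw [mem_massStates] at hf ⊢
  exact ⟨meteorMap_nonneg hf.1 x, (sum_meteorMap hG x f).trans hf.2⟩

/-- The total absolute mass of a signed configuration. -/
def absMass (f : V → ℝ) : ℝ := ∑ v, |f v|

theorem absMass_nonneg (f : V → ℝ) : 0 ≤ absMass f := Finset.sum_nonneg fun _ _ => abs_nonneg _

theorem absMass_meteorMap_le (hG : ∀ x, 0 < (G.neighborSet x).ncard) (x : V) (f : V → ℝ) :
    absMass (meteorMap G x f) ≤ absMass f := by
  unfold absMass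
  rw [← sum_meteorMap hG x fun v => |f v|]
  refine Finset.sum_le_sum fun y _ => ?_
  unfold meteorMap
  split_ifs
  · simp
  · refine (abs_add_le _ _).trans ?_
    rw [abs_div, Nat.abs_cast]
  · exact le_rfl

theorem sum_meteorComp (hG : ∀ x, 0 < (G.neighborSet x).ncard) (L : List V) (f : V → ℝ) :
    ∑ y, meteorComp G L f y = ∑ y, f y := by
  induction L generalizing f with
  | nil => rfl
  | cons x L ih => exact (ih _).trans (sum_meteorMap hG x f)

/-- There is a sequence of hits after which a unit mass started anywhere charges `r`. -/
theorem exists_meteorComp_single_pos (hG : ∀ x, 0 < (G.neighborSet x).ncard)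
    (hconn : G.Connected) (r : V) (s : Finset V) :
    ∃ L : List V, r ∉ L ∧ ∀ v ∈ s, 0 < meteorComp G L (fun j => if v = j then 1 else 0) r := by
  have hδ (v j : V) : (0 : ℝ) ≤ if v = j then 1 else 0 := by split_ifs <;> simp
  induction s using Finset.induction_on with
  | empty => exact ⟨[], by simp, by simp⟩
  | insert v s _ ih =>
    obtain ⟨L, hL, hpos⟩ := ih
    have hnn := meteorComp_nonneg (G := G) L (hδ v)
    obtain ⟨w, hw⟩ : ∃ w, 0 < meteorComp G L (fun j => if v = j then 1 else 0) w := by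
      by_contra! h
      have h1 := sum_meteorComp hG L fun j => if v = j then (1 : ℝ) else 0
      have h2 := Finset.sum_nonpos fun w (_ : w ∈ Finset.univ) => h w
      simp at h1
      linarith
    obtain ⟨p⟩ := hconn.preconnected w r
    obtain ⟨L', hL', hpos'⟩ := exists_meteorComp_pos_of_walk hG p hnn hw
    refine ⟨L ++ L', by simp [hL, hL'], fun u hu => ?_⟩
    rw [meteorComp_append]
    rcases Finset.mem_insert.1 hu with rfl | hu
    · exact hpos'
    · exact (hpos u hu).trans_le (le_meteorComp_of_notMem hL' (meteorComp_nonneg L (hδ u)))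

theorem exists_le_meteorComp (hG : ∀ x, 0 < (G.neighborSet x).ncard) (hconn : G.Connected)
    (r : V) : ∃ L : List V, ∃ ε > 0, ∀ f : V → ℝ, (∀ v, 0 ≤ f v) →
      ε * ∑ v, f v ≤ meteorComp G L f r := by
  obtain ⟨L, -, hL⟩ := exists_meteorComp_single_pos hG hconn r Finset.univ
  have : Nonempty V := ⟨r⟩
  obtain ⟨v₀, hv₀⟩ :=
    Finite.exists_min fun v => meteorComp G L (fun j => if v = j then (1 : ℝ) else 0) r
  refine ⟨L, _, hL v₀ (Finset.mem_univ _), fun f hf => ?_⟩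
  rw [LinearMap.pi_apply_eq_sum_univ (meteorComp G L) f, Finset.sum_apply, Finset.mul_sum]
  refine Finset.sum_le_sum fun v _ => ?_
  rw [Pi.smul_apply, smul_eq_mul, mul_comm]
  exact mul_le_mul_of_nonneg_left (hv₀ v) (hf v)

/-- Some composition of meteor maps strictly contracts signed configurations of total mass zero. -/
theorem exists_absMass_meteorComp_le (hG : ∀ x, 0 < (G.neighborSet x).ncard)
    (hconn : G.Connected) : ∃ L : List V, ∃ ε > 0, ∀ g : V → ℝ, ∑ v, g v = 0 →
      absMass (meteorComp G L g) ≤ (1 - ε) * absMass g := by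
  obtain ⟨r⟩ := hconn.nonempty
  obtain ⟨L, ε, hε, hL⟩ := exists_le_meteorComp hG hconn r
  refine ⟨L, ε, hε, fun g hg => ?_⟩
  set p : V → ℝ := fun v => max (g v) 0 with hp
  set q : V → ℝ := fun v => max (-g v) 0 with hq
  have hp0 (v) : 0 ≤ p v := le_max_right _ _
  have hq0 (v) : 0 ≤ q v := le_max_right _ _
  have hgpq : g = p - q := by
    ext v
    simp only [hp, hq, Pi.sub_apply]
    rcases le_total 0 (g v) with h | h
    · rw [max_eq_left h, max_eq_right (by linarith)]; ring
    · rw [max_eq_right h, max_eq_left (by linarith)]; ring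
  have habs : absMass g = ∑ v, p v + ∑ v, q v := by
    rw [absMass, ← Finset.sum_add_distrib]
    refine Finset.sum_congr rfl fun v _ => ?_
    simp only [hp, hq]
    rcases le_total 0 (g v) with h | h
    · rw [max_eq_left h, max_eq_right (by linarith), abs_of_nonneg h]; ring
    · rw [max_eq_right h, max_eq_left (by linarith), abs_of_nonpos h]; ring
  have hpq : ∑ v, p v = ∑ v, q v := by
    rw [hgpq] at hg
    simp only [Pi.sub_apply, Finset.sum_sub_distrib] at hg
    linarith
  set a := meteorComp G L p
  set b := meteorComp G L q
  have ha0 := meteorComp_nonneg (G := G) L hp0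
  have hb0 := meteorComp_nonneg (G := G) L hq0
  have hab : meteorComp G L g = a - b := by rw [hgpq, map_sub]
  have key : absMass (a - b) ≤ ∑ v, (a v + b v - if v = r then 2 * (ε * ∑ v, p v) else 0) := by
    refine Finset.sum_le_sum fun v _ => ?_
    rw [Pi.sub_apply]
    have h1 : 0 ≤ a v := ha0 v
    have h2 : 0 ≤ b v := hb0 v
    split_ifs with h
    · subst h
      have h3 : ε * ∑ v, p v ≤ a v := hL p hp0
      have h4 : ε * ∑ v, p v ≤ b v := hpq ▸ hL q hq0
      exact abs_le.2 ⟨by linarith, by linarith⟩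
    · exact abs_le.2 ⟨by linarith, by linarith⟩
  rw [Finset.sum_sub_distrib, Finset.sum_add_distrib, sum_meteorComp hG, sum_meteorComp hG,
    Finset.sum_ite_eq' Finset.univ r, if_pos (Finset.mem_univ r)] at key
  rw [hab, habs]
  rw [← hpq] at key ⊢
  linarith

end MeteorMap

section MeteorAvg

variable {V : Type*} [Fintype V] {G : SimpleGraph V}

/-- The meteor kernel acting on functions. -/
noncomputable def meteorAvg (G : SimpleGraph V) (φ : (V → ℝ) → ℝ) (f : V → ℝ) : ℝ :=
  (Fintype.card V : ℝ)⁻¹ * ∑ x, φ (meteorMap G x f)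

theorem meteorAvg_le [Nonempty V] {φ : (V → ℝ) → ℝ} {f : V → ℝ} {c : ℝ}
    (h : ∀ x, φ (meteorMap G x f) ≤ c) : meteorAvg G φ f ≤ c := by
  have hk : (0 : ℝ) < Fintype.card V := by exact_mod_cast Fintype.card_pos
  have := Finset.sum_le_sum fun x (_ : x ∈ Finset.univ) => h x
  rw [Finset.sum_const, nsmul_eq_mul, Finset.card_univ] at this
  rwa [meteorAvg, inv_mul_le_iff₀ hk]

theorem abs_meteorAvg_le [Nonempty V] {φ : (V → ℝ) → ℝ} {f : V → ℝ} {c : ℝ}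
    (h : ∀ x, |φ (meteorMap G x f)| ≤ c) : |meteorAvg G φ f| ≤ c := by
  have h1 := meteorAvg_le (G := G) (φ := φ) fun x => (abs_le.1 (h x)).2
  have h2 := meteorAvg_le (G := G) (φ := fun f => -φ f) (f := f) (c := c) fun x => by
    linarith [(abs_le.1 (h x)).1]
  simp only [meteorAvg, Finset.sum_neg_distrib] at h1 h2
  exact abs_le.2 ⟨by unfold meteorAvg; linarith, h1⟩

theorem continuous_meteorAvg {φ : (V → ℝ) → ℝ} (h : Continuous φ) :
    Continuous (meteorAvg G φ) :=
  continuous_const.mul (continuous_finsetSum _ fun x _ => h.comp (continuous_meteorMap x))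

theorem meteorAvg_iterate_le_mul (hG : ∀ x, 0 < (G.neighborSet x).ncard)
    {φ ψ : (V → ℝ) → ℝ} {c : ℝ} (h : ∀ g : V → ℝ, ∑ v, g v = 0 → φ g ≤ c * ψ g) (n : ℕ)
    (g : V → ℝ) (hg : ∑ v, g v = 0) :
    (meteorAvg G)^[n] φ g ≤ c * (meteorAvg G)^[n] ψ g := by
  induction n generalizing g with
  | zero => exact h g hg
  | succ n ih =>
    rw [Function.iterate_succ_apply', Function.iterate_succ_apply', meteorAvg, meteorAvg,
      mul_left_comm, Finset.mul_sum _ _ c]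
    refine mul_le_mul_of_nonneg_left (Finset.sum_le_sum fun x _ => ?_) (by positivity)
    exact ih _ ((sum_meteorMap hG x g).trans hg)

theorem meteorAvg_iterate_absMass_le [Nonempty V] (hG : ∀ x, 0 < (G.neighborSet x).ncard) (n : ℕ)
    (g : V → ℝ) : (meteorAvg G)^[n] absMass g ≤ absMass g := by
  induction n generalizing g with
  | zero => exact le_rfl
  | succ n ih =>
    rw [Function.iterate_succ_apply']
    exact meteorAvg_le fun x => (ih _).trans (absMass_meteorMap_le hG x g)

/-- The mean absolute mass after `L.length` steps accounts for the contraction along `L`, which is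
followed with probability `|V|⁻¹ ^ L.length`. -/
theorem meteorAvg_iterate_absMass_le_sub [Nonempty V] (hG : ∀ x, 0 < (G.neighborSet x).ncard)
    (L : List V) (g : V → ℝ) :
    (meteorAvg G)^[L.length] absMass g ≤
      absMass g - (Fintype.card V : ℝ)⁻¹ ^ L.length *
        (absMass g - absMass (meteorComp G L g)) := by
  have hk : (0 : ℝ) < Fintype.card V := by exact_mod_cast Fintype.card_pos
  have hk1 : (Fintype.card V : ℝ)⁻¹ ≤ 1 := inv_le_one_of_one_le₀ (by exact_mod_cast Fintype.card_pos)
  induction L generalizing g with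
  | nil => simp
  | cons x L ih =>
    set κ := (Fintype.card V : ℝ)⁻¹ with hκ
    have hκ0 : 0 < κ := inv_pos.2 hk
    set d := κ ^ L.length * (absMass g - absMass (meteorComp G (x :: L) g)) with hd
    have hx : (meteorAvg G)^[L.length] absMass (meteorMap G x g) ≤ absMass g - d := by
      refine (ih _).trans ?_
      have h1 := absMass_meteorMap_le hG x g
      have h2 : κ ^ L.length ≤ 1 := pow_le_one₀ hκ0.le hk1
      rw [hd, meteorComp_cons]
      nlinarith
    have hsum : ∑ y, (meteorAvg G)^[L.length] absMass (meteorMap G y g) ≤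
        ∑ y, (absMass g - if y = x then d else 0) := by
      refine Finset.sum_le_sum fun y _ => ?_
      split_ifs with h
      · exact h ▸ hx
      · rw [sub_zero]
        exact (meteorAvg_iterate_absMass_le hG _ _).trans (absMass_meteorMap_le hG y g)
    rw [Finset.sum_sub_distrib, Finset.sum_const, nsmul_eq_mul, Finset.card_univ,
      Finset.sum_ite_eq' Finset.univ x, if_pos (Finset.mem_univ x)] at hsum
    rw [List.length_cons, Function.iterate_succ_apply', meteorAvg]
    calc κ * _ ≤ κ * (Fintype.card V * absMass g - d) := by gcongr
      _ = absMass g - κ ^ (L.length + 1) * (absMass g - absMass (meteorComp G (x :: L) g)) := by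
        rw [mul_sub, ← mul_assoc, hκ, inv_mul_cancel₀ hk.ne', hd]
        ring

theorem exists_meteorAvg_iterate_absMass_le (hG : ∀ x, 0 < (G.neighborSet x).ncard)
    (hconn : G.Connected) : ∃ N : ℕ, ∃ ρ : ℝ, 0 ≤ ρ ∧ ρ < 1 ∧ ∀ g : V → ℝ, ∑ v, g v = 0 →
      (meteorAvg G)^[N] absMass g ≤ ρ * absMass g := by
  have := hconn.nonempty
  have hk : (0 : ℝ) < Fintype.card V := by exact_mod_cast Fintype.card_pos
  obtain ⟨L, ε, hε, hL⟩ := exists_absMass_meteorComp_le hG hconn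
  set c := (Fintype.card V : ℝ)⁻¹ ^ L.length with hc
  have hc0 : 0 < c := by positivity
  refine ⟨L.length, max 0 (1 - c * ε), le_max_left _ _,
    max_lt one_pos (by nlinarith), fun g hg => ?_⟩
  calc _ ≤ absMass g - c * (absMass g - absMass (meteorComp G L g)) :=
        meteorAvg_iterate_absMass_le_sub hG L g
    _ ≤ (1 - c * ε) * absMass g := by nlinarith [hL g hg]
    _ ≤ _ := mul_le_mul_of_nonneg_right (le_max_right _ _) (absMass_nonneg g)

theorem exists_forall_meteorAvg_iterate_absMass_le (hG : ∀ x, 0 < (G.neighborSet x).ncard)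
    (hconn : G.Connected) {ε : ℝ} (hε : 0 < ε) : ∃ n₀ : ℕ, ∀ n ≥ n₀, ∀ g : V → ℝ,
      ∑ v, g v = 0 → (meteorAvg G)^[n] absMass g ≤ ε * absMass g := by
  have := hconn.nonempty
  obtain ⟨N, ρ, hρ0, hρ1, hN⟩ := exists_meteorAvg_iterate_absMass_le hG hconn
  have key (m : ℕ) : ∀ n ≥ m * N, ∀ g : V → ℝ, ∑ v, g v = 0 →
      (meteorAvg G)^[n] absMass g ≤ ρ ^ m * absMass g := by
    induction m with
    | zero => exact fun n _ g _ => by simpa using meteorAvg_iterate_absMass_le hG n g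
    | succ m ih =>
      intro n hn g hg
      rw [Nat.succ_mul] at hn
      obtain ⟨n', rfl⟩ := Nat.exists_eq_add_of_le' (le_of_add_le_right hn)
      rw [Nat.add_comm n' N, Function.iterate_add_apply, pow_succ, mul_assoc]
      exact (meteorAvg_iterate_le_mul hG (ih n' (by omega)) N g hg).trans
        (mul_le_mul_of_nonneg_left (hN g hg) (pow_nonneg hρ0 m))
  obtain ⟨m, hm⟩ := exists_pow_lt_of_lt_one hε hρ1
  exact ⟨m * N, fun n hn g hg => (key m n hn g hg).trans
    (mul_le_mul_of_nonneg_right hm.le (absMass_nonneg g))⟩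

theorem abs_meteorAvg_iterate_sub_le [Nonempty V] (hG : ∀ x, 0 < (G.neighborSet x).ncard)
    {φ : (V → ℝ) → ℝ} {η C : ℝ}
    (h : ∀ a ∈ massStates V, ∀ b ∈ massStates V, |φ a - φ b| ≤ η + C * absMass (a - b)) (n : ℕ)
    (a : V → ℝ) (ha : a ∈ massStates V) (b : V → ℝ) (hb : b ∈ massStates V) :
    |(meteorAvg G)^[n] φ a - (meteorAvg G)^[n] φ b| ≤
      η + C * (meteorAvg G)^[n] absMass (a - b) := by
  have hk : (Fintype.card V : ℝ) ≠ 0 := by exact_mod_cast Fintype.card_ne_zero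
  induction n generalizing a b with
  | zero => exact h a ha b hb
  | succ n ih =>
    simp only [Function.iterate_succ_apply', meteorAvg]
    rw [← mul_sub, ← Finset.sum_sub_distrib, abs_mul, abs_of_nonneg (by positivity)]
    calc _ ≤ (Fintype.card V : ℝ)⁻¹ *
          ∑ x, (η + C * (meteorAvg G)^[n] absMass (meteorMap G x (a - b))) := by
          gcongr
          refine (Finset.abs_sum_le_sum_abs _ _).trans (Finset.sum_le_sum fun x _ => ?_)
          rw [meteorMap_sub]
          exact ih _ (meteorMap_mem_massStates hG x ha) _ (meteorMap_mem_massStates hG x hb)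
      _ = _ := by
          rw [Finset.sum_add_distrib, Finset.sum_const, nsmul_eq_mul, Finset.card_univ,
            ← Finset.mul_sum]
          field_simp

theorem dist_le_absMass_sub (a b : V → ℝ) : dist a b ≤ absMass (a - b) :=
  (dist_pi_le_iff (absMass_nonneg _)).2 fun v => by
    rw [Real.dist_eq]
    exact Finset.single_le_sum (f := fun v => |(a - b) v|) (fun _ _ => abs_nonneg _)
      (Finset.mem_univ v)

/-- A continuous function has a linear modulus of continuity on `massStates V`, up to an
arbitrarily small additive error. -/
theorem exists_abs_sub_le_add_mul_absMass {φ : (V → ℝ) → ℝ} (hφ : Continuous φ) {η : ℝ}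
    (hη : 0 < η) : ∃ C ≥ 0, ∀ a ∈ massStates V, ∀ b ∈ massStates V,
      |φ a - φ b| ≤ η + C * absMass (a - b) := by
  obtain ⟨M, hM⟩ := isCompact_massStates.exists_bound_of_continuousOn hφ.continuousOn
  obtain ⟨δ, hδ, hδφ⟩ := Metric.uniformContinuousOn_iff.1
    (isCompact_massStates.uniformContinuousOn_of_continuous hφ.continuousOn) η hη
  refine ⟨2 * |M| / δ, by positivity, fun a ha b hb => ?_⟩
  have hm := absMass_nonneg (a - b)
  rcases lt_or_ge (dist a b) δ with hd | hd
  · have h1 := hδφ a ha b hb hd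
    rw [Real.dist_eq] at h1
    have : 0 ≤ 2 * |M| / δ * absMass (a - b) := by positivity
    linarith
  · have h1 := hM a ha
    have h2 := hM b hb
    rw [Real.norm_eq_abs] at h1 h2
    have h3 : 2 * |M| ≤ 2 * |M| / δ * absMass (a - b) := by
      rw [div_mul_eq_mul_div, le_div_iff₀ hδ]
      exact mul_le_mul_of_nonneg_left (hd.trans (dist_le_absMass_sub a b)) (by positivity)
    have h4 := abs_sub (φ a) (φ b)
    linarith [le_abs_self M]

/-- The chain forgets its initial state uniformly on `massStates V`. -/
theorem exists_forall_abs_meteorAvg_iterate_sub_le (hG : ∀ x, 0 < (G.neighborSet x).ncard)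
    (hconn : G.Connected) {φ : (V → ℝ) → ℝ} (hφ : Continuous φ) {ε : ℝ} (hε : 0 < ε) :
    ∃ n₀ : ℕ, ∀ n ≥ n₀, ∀ a ∈ massStates V, ∀ b ∈ massStates V,
      |(meteorAvg G)^[n] φ a - (meteorAvg G)^[n] φ b| ≤ ε := by
  have := hconn.nonempty
  have hk : (0 : ℝ) < Fintype.card V := by exact_mod_cast Fintype.card_pos
  obtain ⟨C, hC, hφC⟩ := exists_abs_sub_le_add_mul_absMass hφ (half_pos hε)
  set D := (C + 1) * (2 * (Fintype.card V : ℝ)) with hD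
  have hD0 : 0 < D := by positivity
  obtain ⟨n₀, hn₀⟩ := exists_forall_meteorAvg_iterate_absMass_le hG hconn
    (div_pos (half_pos hε) hD0)
  refine ⟨n₀, fun n hn a ha b hb =>
    (abs_meteorAvg_iterate_sub_le hG hφC n a ha b hb).trans ?_⟩
  rw [mem_massStates] at ha hb
  have h0 : ∑ v, (a - b) v = 0 := by simp [ha.2, hb.2]
  have hle : absMass (a - b) ≤ 2 * (Fintype.card V : ℝ) := by
    calc absMass (a - b) ≤ ∑ v, (a v + b v) := Finset.sum_le_sum fun v _ =>
          abs_le.2 ⟨by simp; linarith [ha.1 v], by simp; linarith [hb.1 v]⟩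
      _ = _ := by rw [Finset.sum_add_distrib, ha.2, hb.2]; ring
  have hs : ε / 2 / D * absMass (a - b) ≤ ε / 2 / D * (2 * (Fintype.card V : ℝ)) := by gcongr
  calc ε / 2 + C * (meteorAvg G)^[n] absMass (a - b)
      ≤ ε / 2 + C * (ε / 2 / D * (2 * (Fintype.card V : ℝ))) := by
        gcongr
        exact (hn₀ n hn _ h0).trans hs
    _ ≤ ε / 2 + (C + 1) * (ε / 2 / D * (2 * (Fintype.card V : ℝ))) := by gcongr; linarith
    _ = ε / 2 + ε / 2 / D * D := by rw [hD]; ring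
    _ = ε := by rw [div_mul_cancel₀ _ hD0.ne']; ring

end MeteorAvg

section MeteorStep

variable {V : Type*} {G : SimpleGraph V}

/-- Integrals of a function that is nearly constant on `massStates V` nearly agree. -/
theorem abs_integral_sub_integral_le {ψ : (V → ℝ) → ℝ} {μ ν : Measure (V → ℝ)}
    [IsProbabilityMeasure μ] [IsProbabilityMeasure ν] (hμ : ∀ᵐ f ∂μ, f ∈ massStates V)
    (hν : ∀ᵐ f ∂ν, f ∈ massStates V) (hψμ : Integrable ψ μ) (hψν : Integrable ψ ν) {ε : ℝ}
    (h : ∀ a ∈ massStates V, ∀ b ∈ massStates V, |ψ a - ψ b| ≤ ε) :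
    |∫ f, ψ f ∂μ - ∫ f, ψ f ∂ν| ≤ ε := by
  have hb (b : V → ℝ) (hb : b ∈ massStates V) : |∫ f, ψ f ∂μ - ψ b| ≤ ε := by
    have := norm_integral_le_of_norm_le_const (μ := μ) (f := fun f => ψ f - ψ b) (C := ε)
      (hμ.mono fun a ha => h a ha b hb)
    rw [integral_sub hψμ (integrable_const _)] at this
    simpa using this
  have := norm_integral_le_of_norm_le_const (μ := ν) (f := fun b => ∫ f, ψ f ∂μ - ψ b) (C := ε)
    (hν.mono fun b hb' => hb b hb')
  rw [integral_sub (integrable_const _) hψν] at this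
  simpa using this

variable [Fintype V]

theorem meteorStep_eq_sum (μ : Measure (V → ℝ)) :
    meteorStep G μ = (Fintype.card V : ℝ≥0∞)⁻¹ • ∑ x : V, μ.map (meteorMap G x) := by
  rw [meteorStep, finsum_eq_sum_of_fintype, Nat.card_eq_fintype_card]

theorem isProbabilityMeasure_meteorStep [Nonempty V] (μ : Measure (V → ℝ))
    [IsProbabilityMeasure μ] : IsProbabilityMeasure (meteorStep G μ) := by
  have (x : V) : IsProbabilityMeasure (μ.map (meteorMap G x)) :=
    Measure.isProbabilityMeasure_map (continuous_meteorMap x).aemeasurable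
  constructor
  simp only [meteorStep_eq_sum, Measure.smul_apply, Measure.finsetSum_apply, measure_univ,
    Finset.sum_const, Finset.card_univ, nsmul_eq_mul, mul_one, smul_eq_mul]
  exact ENNReal.inv_mul_cancel (by exact_mod_cast Fintype.card_ne_zero) (ENNReal.natCast_ne_top _)

theorem ae_mem_massStates_meteorStep (hG : ∀ x, 0 < (G.neighborSet x).ncard)
    {μ : Measure (V → ℝ)} (h : ∀ᵐ f ∂μ, f ∈ massStates V) :
    ∀ᵐ f ∂meteorStep G μ, f ∈ massStates V := by
  have hmap (x : V) : μ.map (meteorMap G x) (massStates V)ᶜ = 0 := by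
    rw [Measure.map_apply (continuous_meteorMap x).measurable
      isCompact_massStates.isClosed.measurableSet.compl]
    exact measure_mono_null (fun f hf hf' => hf (meteorMap_mem_massStates hG x hf')) h
  change meteorStep G μ (massStates V)ᶜ = 0
  simp [meteorStep_eq_sum, Measure.finsetSum_apply, hmap]

theorem integrable_of_continuous_of_bound {φ : (V → ℝ) → ℝ} (hφ : Continuous φ) {C : ℝ}
    (hC : ∀ f, |φ f| ≤ C) (μ : Measure (V → ℝ)) [IsFiniteMeasure μ] : Integrable φ μ :=
  Integrable.of_bound hφ.aestronglyMeasurable C (Eventually.of_forall hC)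

theorem integral_meteorStep {φ : (V → ℝ) → ℝ} (hφ : Continuous φ) {C : ℝ}
    (hC : ∀ f, |φ f| ≤ C) (μ : Measure (V → ℝ)) [IsFiniteMeasure μ] :
    ∫ f, φ f ∂(meteorStep G μ) = ∫ f, meteorAvg G φ f ∂μ := by
  simp only [meteorAvg]
  rw [meteorStep_eq_sum, integral_smul_measure, integral_const_mul,
    integral_finsetSum_measure fun x _ => integrable_of_continuous_of_bound hφ hC _,
    integral_finsetSum (f := fun x f => φ (meteorMap G x f)) _ fun x _ =>
      integrable_of_continuous_of_bound (hφ.comp (continuous_meteorMap x)) (fun _ => hC _) _]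
  simp [integral_map (continuous_meteorMap _).aemeasurable hφ.aestronglyMeasurable]

theorem isProbabilityMeasure_iterate_meteorStep [Nonempty V] (n : ℕ) (μ : Measure (V → ℝ))
    [IsProbabilityMeasure μ] : IsProbabilityMeasure ((meteorStep G)^[n] μ) := by
  induction n with
  | zero => assumption
  | succ n ih =>
    rw [Function.iterate_succ_apply']
    exact isProbabilityMeasure_meteorStep _

theorem ae_mem_massStates_iterate_meteorStep (hG : ∀ x, 0 < (G.neighborSet x).ncard) (n : ℕ)
    {μ : Measure (V → ℝ)} (h : ∀ᵐ f ∂μ, f ∈ massStates V) :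
    ∀ᵐ f ∂(meteorStep G)^[n] μ, f ∈ massStates V := by
  induction n with
  | zero => exact h
  | succ n ih =>
    rw [Function.iterate_succ_apply']
    exact ae_mem_massStates_meteorStep hG ih

theorem continuous_iterate_meteorAvg {φ : (V → ℝ) → ℝ} (hφ : Continuous φ) (n : ℕ) :
    Continuous ((meteorAvg G)^[n] φ) := by
  induction n with
  | zero => exact hφ
  | succ n ih =>
    rw [Function.iterate_succ_apply']
    exact continuous_meteorAvg ih

theorem abs_iterate_meteorAvg_le [Nonempty V] {φ : (V → ℝ) → ℝ} {C : ℝ} (hC : ∀ f, |φ f| ≤ C)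
    (n : ℕ) (f : V → ℝ) : |(meteorAvg G)^[n] φ f| ≤ C := by
  induction n generalizing f with
  | zero => exact hC f
  | succ n ih =>
    rw [Function.iterate_succ_apply']
    exact abs_meteorAvg_le fun x => ih _

theorem integral_iterate_meteorStep [Nonempty V] {φ : (V → ℝ) → ℝ} (hφ : Continuous φ) {C : ℝ}
    (hC : ∀ f, |φ f| ≤ C) (n : ℕ) (μ : Measure (V → ℝ)) [IsProbabilityMeasure μ] :
    ∫ f, φ f ∂((meteorStep G)^[n] μ) = ∫ f, (meteorAvg G)^[n] φ f ∂μ := by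
  induction n generalizing μ with
  | zero => rfl
  | succ n ih =>
    have := isProbabilityMeasure_meteorStep (G := G) μ
    rw [Function.iterate_succ_apply, ih, Function.iterate_succ_apply',
      integral_meteorStep (continuous_iterate_meteorAvg hφ n) (abs_iterate_meteorAvg_le hC n)]

theorem ae_mem_massStates_iff (μ : Measure (V → ℝ)) [IsProbabilityMeasure μ] :
    (∀ᵐ f ∂μ, f ∈ massStates V) ↔ μ (massStates V) = 1 :=
  prob_compl_eq_zero_iff isCompact_massStates.isClosed.measurableSet

theorem tendsto_integral_iterate_sub (hG : ∀ x, 0 < (G.neighborSet x).ncard)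
    (hconn : G.Connected) {φ : (V → ℝ) → ℝ} (hφ : Continuous φ) {C : ℝ} (hC : ∀ f, |φ f| ≤ C)
    {μ ν : Measure (V → ℝ)} [IsProbabilityMeasure μ] [IsProbabilityMeasure ν]
    (hμ : ∀ᵐ f ∂μ, f ∈ massStates V) (hν : ∀ᵐ f ∂ν, f ∈ massStates V) :
    Tendsto (fun n : ℕ => ∫ f, φ f ∂((meteorStep G)^[n] μ) - ∫ f, φ f ∂((meteorStep G)^[n] ν))
      atTop (𝓝 0) := by
  have := hconn.nonempty
  refine Metric.tendsto_atTop.2 fun ε hε => ?_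
  obtain ⟨n₀, hn₀⟩ := exists_forall_abs_meteorAvg_iterate_sub_le hG hconn hφ (half_pos hε)
  refine ⟨n₀, fun n hn => ?_⟩
  have hint (ξ : Measure (V → ℝ)) [IsProbabilityMeasure ξ] :=
    integrable_of_continuous_of_bound (continuous_iterate_meteorAvg (G := G) hφ n)
      (abs_iterate_meteorAvg_le hC n) ξ
  rw [Real.dist_eq, sub_zero, integral_iterate_meteorStep hφ hC, integral_iterate_meteorStep hφ hC]
  exact (abs_integral_sub_integral_le hμ hν (hint μ) (hint ν) (hn₀ n hn)).trans_lt (half_lt_self hε)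

/-- A weak limit of the laws of the chain started from a point is invariant. -/
theorem exists_invariant_meteorStep (hG : ∀ x, 0 < (G.neighborSet x).ncard)
    (hconn : G.Connected) : ∃ Q : Measure (V → ℝ), IsProbabilityMeasure Q ∧
      (∀ᵐ f ∂Q, f ∈ massStates V) ∧ meteorStep G Q = Q := by
  have := hconn.nonempty
  set μ : Measure (V → ℝ) := Measure.dirac fun _ => 1
  have hμ : ∀ᵐ f ∂μ, f ∈ massStates V :=
    (ae_dirac_iff isCompact_massStates.isClosed.measurableSet).2
      (mem_massStates.2 ⟨fun _ => zero_le_one, by simp⟩)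
  have hstep := isProbabilityMeasure_meteorStep (G := G) μ
  let P (n : ℕ) : ProbabilityMeasure (V → ℝ) :=
    ⟨(meteorStep G)^[n] μ, isProbabilityMeasure_iterate_meteorStep n μ⟩
  have hcomp : IsCompact {ν : ProbabilityMeasure (V → ℝ) |
      ∀ _ : ℕ, ν (massStates V)ᶜ ≤ (0 : NNReal)} :=
    isCompact_setOfPred_probabilityMeasure_mass_eq_compl_isCompact_le (u := fun _ => 0)
      tendsto_const_nhds (fun _ => isCompact_massStates) (Or.inl inferInstance)
  have hmem (ν : ProbabilityMeasure (V → ℝ)) : (∀ _ : ℕ, ν (massStates V)ᶜ ≤ (0 : NNReal)) ↔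
      ∀ᵐ f ∂(ν : Measure (V → ℝ)), f ∈ massStates V := by
    simp [ae_iff, ProbabilityMeasure.null_iff_toMeasure_null, Set.compl_def]
  obtain ⟨Q, hQ, hlim⟩ := hcomp.ultrafilter_le_nhds ((hyperfilter ℕ).map P) (by
    rw [Ultrafilter.coe_map, le_principal_iff, mem_map]
    exact Eventually.of_forall fun n : ℕ =>
      (hmem (P n)).2 (ae_mem_massStates_iterate_meteorStep hG n hμ))
  replace hlim : Tendsto P (hyperfilter ℕ) (𝓝 Q) := hlim
  rw [ProbabilityMeasure.tendsto_iff_forall_integral_tendsto] at hlim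
  refine ⟨Q, inferInstance, (hmem Q).1 hQ, ?_⟩
  have := isProbabilityMeasure_meteorStep (G := G) (Q : Measure (V → ℝ))
  refine ext_of_forall_integral_eq_of_IsFiniteMeasure fun φ => ?_
  have hφ := φ.continuous
  have hC (f : V → ℝ) : |φ f| ≤ ‖φ‖ := φ.norm_coe_le_norm f
  have hC' (f : V → ℝ) : |meteorAvg G φ f| ≤ ‖φ‖ := abs_meteorAvg_le fun x => hC _
  have h1 := hlim (BoundedContinuousFunction.ofNormedAddCommGroup (meteorAvg G φ)
    (continuous_meteorAvg hφ) ‖φ‖ hC')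
  have h2 := (hlim φ).add ((tendsto_integral_iterate_sub hG hconn hφ hC
    (ae_mem_massStates_meteorStep hG hμ) hμ).mono_left Nat.hyperfilter_le_atTop)
  rw [add_zero] at h2
  rw [integral_meteorStep hφ hC]
  refine tendsto_nhds_unique h1 (h2.congr fun n => ?_)
  have := (P n).2
  have h3 := integral_meteorStep (G := G) hφ hC ((meteorStep G)^[n] μ)
  rw [← Function.iterate_succ_apply' (meteorStep G), Function.iterate_succ_apply] at h3
  simp [P, h3]

end MeteorStep

/-- For a finite connected simple graph `G` with `|V| = k ≥ 2`, the meteor kernel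
admits a unique invariant probability measure `Q` on the state space
`S_G = {f : V → ℝ : f ≥ 0, ∑ f = k}`, and for every initial probability distribution `μ` on
`S_G` the distribution after `n` steps converges weakly to `Q` as `n → ∞`; in particular the
limit does not depend on the initial distribution. -/
theorem meteor_unique_stationary_and_convergence {V : Type*} [Fintype V]
    (G : SimpleGraph V) (hconn : G.Connected) (hk : 2 ≤ Fintype.card V) :
    ∃ Q : Measure (V → ℝ),
      (IsProbabilityMeasure Q ∧ Q (massStates V) = 1 ∧ meteorStep G Q = Q) ∧
      (∀ Q' : Measure (V → ℝ),
        IsProbabilityMeasure Q' → Q' (massStates V) = 1 → meteorStep G Q' = Q' → Q' = Q) ∧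
      (∀ μ : Measure (V → ℝ), IsProbabilityMeasure μ → μ (massStates V) = 1 →
        ∀ φ : BoundedContinuousFunction (V → ℝ) ℝ,
          Tendsto (fun n : ℕ => ∫ f, φ f ∂((meteorStep G)^[n] μ)) atTop
            (𝓝 (∫ f, φ f ∂Q))) := by
  have : Nontrivial V := Fintype.one_lt_card_iff_nontrivial.1 hk
  have hG (x : V) : 0 < (G.neighborSet x).ncard := by
    rw [Set.ncard_pos]
    exact hconn.preconnected.exists_adj_of_nontrivial x
  obtain ⟨Q, hQ, hQmem, hQinv⟩ := exists_invariant_meteorStep hG hconn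
  have hconv (μ : Measure (V → ℝ)) (hμ : IsProbabilityMeasure μ) (hμ1 : μ (massStates V) = 1)
      (φ : BoundedContinuousFunction (V → ℝ) ℝ) :
      Tendsto (fun n : ℕ => ∫ f, φ f ∂((meteorStep G)^[n] μ)) atTop (𝓝 (∫ f, φ f ∂Q)) := by
    have := tendsto_integral_iterate_sub hG hconn φ.continuous φ.norm_coe_le_norm
      ((ae_mem_massStates_iff μ).2 hμ1) hQmem
    simp only [Function.iterate_fixed hQinv] at this
    exact tendsto_sub_nhds_zero_iff.1 this
  refine ⟨Q, ⟨hQ, (ae_mem_massStates_iff Q).1 hQmem, hQinv⟩, fun Q' hQ' hQ'1 hQ'inv => ?_, hconv⟩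
  refine ext_of_forall_integral_eq_of_IsFiniteMeasure fun φ => ?_
  have := hconv Q' hQ' hQ'1 φ
  simp only [Function.iterate_fixed hQ'inv] at this
  exact tendsto_nhds_unique tendsto_const_nhds this
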